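/- Let E be a C*-algebra and B a norm-closed subalgebra of E such that the C*-subalgebra of E generated by B is all of E. Let A be a norm-closed two-sided ideal of B admitting a contractive approximate identity, and let J be the C*-subalgebra of E generated by A. Assume J is an essential ideal of E, i.e., for x ∈ E, if x·j = 0 and j·x = 0 for all j ∈ J then x = 0. Then for every b ∈ B one has ‖b‖ = sup{‖b·a‖ : a ∈ A, ‖a‖ ≤ 1}; in particular the canonical homomorphism from B into the multiplier algebra of A is isometric. -/

import Mathlib

open Filter Topology Metric

/-- `S` is a norm-closed (not necessarily self-adjoint or unital) subalgebra:
a norm-closed ℂ-linear subspace closed under multiplication. -/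
structure IsClosedSubalg (X : Type*) [NonUnitalNormedRing X] [NormedSpace ℂ X]
    (S : Set X) : Prop where
  isClosed : IsClosed S
  zero_mem : (0 : X) ∈ S
  add_mem : ∀ {x y : X}, x ∈ S → y ∈ S → x + y ∈ S
  smul_mem : ∀ (c : ℂ) {x : X}, x ∈ S → c • x ∈ S
  mul_mem : ∀ {x y : X}, x ∈ S → y ∈ S → x * y ∈ S

/-- A contractive net drawn from `A` which is a two-sided approximate identity for `D`. -/
def IsCaiFor (X : Type*) [NonUnitalNormedRing X] (A D : Set X) : Prop :=
  ∃ (ι : Type) (l : Filter ι) (e : ι → X), l.NeBot ∧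
    (∀ t, e t ∈ A) ∧ (∀ t, ‖e t‖ ≤ 1) ∧
    (∀ d ∈ D, Tendsto (fun t => ‖e t * d - d‖) l (𝓝 0)) ∧
    (∀ d ∈ D, Tendsto (fun t => ‖d * e t - d‖) l (𝓝 0))

/-- The C*-subalgebra of `E` generated by a subset `S`: the smallest norm-closed subalgebra
of `E` containing `S` and closed under the involution. -/
def cstarGen (E : Type*) [NonUnitalNormedRing E] [NormedSpace ℂ E] [Star E]
    (S : Set E) : Set E :=
  ⋂₀ {J : Set E | IsClosedSubalg E J ∧ (∀ x ∈ J, star x ∈ J) ∧ S ⊆ J}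

/-- The left fixed points of a contractive net form a closed set. -/
lemma isClosed_setOf_tendsto_mul_left {E ι : Type*} [NonUnitalNormedRing E] {l : Filter ι}
    {u : ι → E} (hu : ∀ t, ‖u t‖ ≤ 1) :
    IsClosed {x : E | Tendsto (fun t => u t * x) l (𝓝 x)} := by
  refine isClosed_of_closure_subset fun x hx => ?_
  rw [Set.mem_ofPred_eq, Metric.tendsto_nhds]
  intro ε hε
  obtain ⟨y, hy, hxy⟩ := Metric.mem_closure_iff.1 hx (ε / 3) (by positivity)
  filter_upwards [Metric.tendsto_nhds.1 hy (ε / 3) (by positivity)] with t ht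
  have h : dist (u t * x) (u t * y) ≤ dist x y := by
    rw [dist_eq_norm, dist_eq_norm, ← mul_sub]
    exact (norm_mul_le _ _).trans (mul_le_of_le_one_left (norm_nonneg _) (hu t))
  have h₁ := dist_triangle4 (u t * x) (u t * y) y x
  rw [dist_comm y x] at h₁
  linarith

/-- If a contractive net is a right approximate identity at `a`, so is its adjoint net. -/
lemma tendsto_mul_star_of_tendsto_mul {E ι : Type*} [NonUnitalCStarAlgebra E] {l : Filter ι}
    {u : ι → E} (hu : ∀ t, ‖u t‖ ≤ 1) {a : E} (h : Tendsto (fun t => a * u t) l (𝓝 a)) :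
    Tendsto (fun t => a * star (u t)) l (𝓝 a) := by
  let _ := CStarAlgebra.spectralOrder E
  have _ := CStarAlgebra.spectralOrderedRing E
  have h₁ : Tendsto (fun t => a * star a - a * u t * star a) l (𝓝 0) := by
    simpa using (h.mul_const (star a)).const_sub (a * star a)
  have h₂ : Tendsto (fun t => (a * star a - a * u t * star a)
      + star (a * star a - a * u t * star a)) l (𝓝 0) := by
    simpa using h₁.add h₁.star
  rw [tendsto_iff_norm_sub_tendsto_zero]
  have h₃ : Tendsto (fun t => Real.sqrt ‖(a * star a - a * u t * star a)
      + star (a * star a - a * u t * star a)‖) l (𝓝 0) := by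
    simpa only [norm_zero, Real.sqrt_zero, Function.comp_def] using
      (Real.continuous_sqrt.tendsto _).comp h₂.norm
  refine squeeze_zero (fun _ => norm_nonneg _) (fun t => ?_) h₃
  refine Real.le_sqrt_of_sq_le ?_
  rw [sq, ← CStarRing.norm_self_mul_star]
  refine CStarAlgebra.norm_le_norm_of_nonneg_of_le (mul_star_self_nonneg _) ?_
  have h₄ : a * (star (u t) * u t) * star a ≤ a * star a := by
    refine (CStarAlgebra.star_right_conjugate_le_norm_smul).trans ?_
    have h₅ : ‖star (u t) * u t‖ ≤ 1 := by
      rw [CStarRing.norm_star_mul_self]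
      exact mul_le_one₀ (hu t) (norm_nonneg _) (hu t)
    simpa using smul_le_smul_of_nonneg_right h₅ (mul_star_self_nonneg a)
  rw [← sub_nonneg] at h₄ ⊢
  convert h₄ using 1
  simp only [star_sub, star_mul, star_star]
  noncomm_ring

/-- In a C*-algebra, the norm of an element is determined by left multiplication on any
left-invariant set with no nonzero selfadjoint left annihilator. -/
lemma norm_le_of_forall_norm_mul_le {E : Type*} [NonUnitalCStarAlgebra E] {J : Set E}
    (hJ : ∀ x : E, ∀ j ∈ J, x * j ∈ J)
    (hess : ∀ c : E, IsSelfAdjoint c → (∀ j ∈ J, c * j = 0) → c = 0)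
    {b : E} {s : ℝ} (hs : 0 ≤ s) (hb : ∀ j ∈ J, ‖b * j‖ ≤ s * ‖j‖) : ‖b‖ ≤ s := by
  let _ := CStarAlgebra.spectralOrder E
  have _ := CStarAlgebra.spectralOrderedRing E
  refine le_of_forall_gt_imp_ge_of_dense fun r hr => ?_
  have hr₀ : 0 ≤ r := hs.trans hr.le
  set h : E := star b * b with hh
  have hsa : IsSelfAdjoint h := .star_mul_self b
  have hpos : 0 ≤ h := star_mul_self_nonneg b
  set f : ℝ → ℝ := fun x => max (x - r ^ 2) 0 with hf
  have hf₀ : f 0 = 0 := by simp [hf, sq_nonneg]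
  have hfc : Continuous f := by fun_prop
  set c : E := cfcₙ f h with hc
  have hcsa : IsSelfAdjoint c := cfcₙ_predicate f h
  have hchc : r ^ 2 • (c * c) ≤ c * h * c := by
    have h₁ : c * h * c = cfcₙ (fun x => f x * x * f x) h := by
      rw [cfcₙ_mul (fun x => f x * x) f h (by fun_prop) (by simp) (by fun_prop) hf₀,
        cfcₙ_mul f (fun x => x) h (by fun_prop) hf₀ (by fun_prop) rfl, cfcₙ_id' ℝ h]
    have h₂ : r ^ 2 • (c * c) = cfcₙ (fun x => r ^ 2 • (f x * f x)) h := by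
      rw [cfcₙ_smul (r ^ 2) (fun x => f x * f x) h (by fun_prop) (by simp [hf₀]),
        cfcₙ_mul f f h (by fun_prop) hf₀ (by fun_prop) hf₀]
    rw [h₁, h₂]
    refine cfcₙ_mono (fun x _ => ?_) (by fun_prop) (by fun_prop) (by simp [hf₀]) (by simp)
    rcases le_total x (r ^ 2) with hx | hx
    · simp [hf, hx]
    · have := mul_self_nonneg (f x)
      simp only [smul_eq_mul]
      nlinarith
  have hc₀ : c = 0 := by
    refine hess c hcsa fun j hj => ?_
    by_contra hne
    have hy : 0 < ‖c * j‖ := norm_pos_iff.2 hne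
    have h₁ : r ^ 2 • (star (c * j) * (c * j)) ≤ star (b * (c * j)) * (b * (c * j)) := by
      have := star_left_conjugate_le_conjugate hchc j
      simpa [hh, hcsa.star_eq, mul_assoc, mul_smul_comm, smul_mul_assoc] using this
    have h₂ := CStarAlgebra.norm_le_norm_of_nonneg_of_le
      (smul_nonneg (sq_nonneg r) (star_mul_self_nonneg _)) h₁
    rw [norm_smul, CStarRing.norm_star_mul_self, CStarRing.norm_star_mul_self,
      Real.norm_of_nonneg (sq_nonneg r)] at h₂
    have h₃ := hb _ (hJ c j hj)
    have h₄ : s * ‖c * j‖ < r * ‖c * j‖ := mul_lt_mul_of_pos_right hr hy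
    nlinarith [norm_nonneg (b * (c * j))]
  have hfz : ∀ x ∈ quasispectrum ℝ h, x ≤ r ^ 2 := by
    intro x hx
    have h₁ := norm_apply_le_norm_cfcₙ f h hx (by fun_prop) hf₀ hsa
    rw [← hc, hc₀, norm_zero, norm_le_zero_iff] at h₁
    have h₂ : x - r ^ 2 ≤ f x := le_max_left _ _
    linarith
  have hn : ‖h‖ ≤ r ^ 2 := by
    rw [← cfcₙ_id' ℝ h]
    refine norm_cfcₙ_le fun x hx => ?_
    rw [Real.norm_of_nonneg (quasispectrum_nonneg_of_nonneg h hpos x hx)]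
    exact hfz x hx
  rw [hh, CStarRing.norm_star_mul_self, ← sq] at hn
  exact le_of_sq_le_sq hn hr₀

section cstarGen

variable {E : Type*} [NonUnitalNormedRing E] [NormedSpace ℂ E] [Star E] {S T : Set E}

lemma cstarGen_subset (hT : IsClosedSubalg E T) (hstar : ∀ x ∈ T, star x ∈ T) (hST : S ⊆ T) :
    cstarGen E S ⊆ T :=
  Set.sInter_subset_of_mem ⟨hT, hstar, hST⟩

lemma subset_cstarGen : S ⊆ cstarGen E S :=
  Set.subset_sInter fun _ hT => hT.2.2

lemma star_mem_cstarGen {x : E} (hx : x ∈ cstarGen E S) : star x ∈ cstarGen E S :=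
  Set.mem_sInter.2 fun T hT => hT.2.1 x (Set.mem_sInter.1 hx T hT)

lemma isClosedSubalg_cstarGen : IsClosedSubalg E (cstarGen E S) where
  isClosed := isClosed_sInter fun _ hT => hT.1.isClosed
  zero_mem := Set.mem_sInter.2 fun _ hT => hT.1.zero_mem
  add_mem hx hy := Set.mem_sInter.2 fun T hT =>
    hT.1.add_mem (Set.mem_sInter.1 hx T hT) (Set.mem_sInter.1 hy T hT)
  smul_mem c _ hx := Set.mem_sInter.2 fun T hT => hT.1.smul_mem c (Set.mem_sInter.1 hx T hT)
  mul_mem hx hy := Set.mem_sInter.2 fun T hT =>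
    hT.1.mul_mem (Set.mem_sInter.1 hx T hT) (Set.mem_sInter.1 hy T hT)

end cstarGen

/-- A contractive approximate identity of `A`, and its adjoint net, are left approximate
identities of the C*-algebra generated by `A`. -/
lemma tendsto_mul_of_mem_cstarGen {E ι : Type*} [NonUnitalCStarAlgebra E] {A : Set E}
    {l : Filter ι} {e : ι → E} (he : ∀ t, ‖e t‖ ≤ 1)
    (hleft : ∀ a ∈ A, Tendsto (fun t => e t * a) l (𝓝 a))
    (hright : ∀ a ∈ A, Tendsto (fun t => a * e t) l (𝓝 a)) {x : E} (hx : x ∈ cstarGen E A) :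
    Tendsto (fun t => e t * x) l (𝓝 x) ∧ Tendsto (fun t => star (e t) * x) l (𝓝 x) := by
  have he' : ∀ t, ‖star (e t)‖ ≤ 1 := by simpa using he
  have hadj : ∀ {u : ι → E} {a : E}, Tendsto (fun t => u t * a) l (𝓝 a) →
      Tendsto (fun t => star a * star (u t)) l (𝓝 (star a)) := fun h => by
    simpa using h.star
  have hadj' : ∀ {u : ι → E} {a : E}, Tendsto (fun t => a * u t) l (𝓝 a) →
      Tendsto (fun t => star (u t) * star a) l (𝓝 (star a)) := fun h => by
    simpa using h.star
  let P : Set E := {x | Tendsto (fun t => e t * x) l (𝓝 x)} ∩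
    {x | Tendsto (fun t => star (e t) * x) l (𝓝 x)}
  have hP : IsClosed P :=
    (isClosed_setOf_tendsto_mul_left he).inter (isClosed_setOf_tendsto_mul_left he')
  have hPzero : (0 : E) ∈ P := by simp [P, tendsto_const_nhds]
  have hPadd : ∀ {x y : E}, x ∈ P → y ∈ P → x + y ∈ P := fun hx hy =>
    ⟨by simpa [mul_add] using hx.1.add hy.1, by simpa [mul_add] using hx.2.add hy.2⟩
  have hPsmul : ∀ (c : ℂ) {x : E}, x ∈ P → c • x ∈ P := fun c x hx =>
    ⟨by simpa [mul_smul_comm] using hx.1.const_smul c,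
      by simpa [mul_smul_comm] using hx.2.const_smul c⟩
  have hPmul : ∀ {x : E} (y : E), x ∈ P → x * y ∈ P := fun y hx =>
    ⟨by simpa [mul_assoc] using hx.1.mul_const y, by simpa [mul_assoc] using hx.2.mul_const y⟩
  refine (cstarGen_subset (T := {x | x ∈ P ∧ star x ∈ P}) ⟨?_, ?_, ?_, ?_, ?_⟩ ?_ ?_ hx).1
  · exact hP.inter (hP.preimage continuous_star)
  · exact ⟨hPzero, by simpa using hPzero⟩
  · exact fun hx hy => ⟨hPadd hx.1 hy.1, by simpa using hPadd hx.2 hy.2⟩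
  · exact fun c x hx => ⟨hPsmul c hx.1, by simpa using hPsmul (star c) hx.2⟩
  · exact fun hx hy => ⟨hPmul _ hx.1, by simpa using hPmul _ hy.2⟩
  · exact fun x hx => ⟨hx.2, by simpa using hx.1⟩
  · intro a ha
    have h := tendsto_mul_star_of_tendsto_mul he' (hadj (hleft a ha))
    refine ⟨⟨hleft a ha, ?_⟩, ?_, hadj' (hright a ha)⟩
    · simpa only [star_star, Set.mem_ofPred_eq] using hadj' h
    · simpa using hadj' (tendsto_mul_star_of_tendsto_mul he (hright a ha))

/-- Let `B` be a closed subalgebra of a C*-algebra `E` which generates `E` as a C*-algebra,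
and `A` a closed two-sided ideal of `B` with a contractive approximate identity, such that
the C*-subalgebra `J` of `E` generated by `A` is an essential ideal of `E`.  Then
`‖b‖ = sup{‖b·a‖ : a ∈ A, ‖a‖ ≤ 1}` for all `b ∈ B`; in particular the canonical
homomorphism `B → M(A)` is isometric. -/
theorem stmt6 {E : Type*} [NonUnitalCStarAlgebra E]
    (B A : Set E)
    (hB : IsClosedSubalg E B) (hBgen : cstarGen E B = Set.univ)
    (hA : IsClosedSubalg E A) (hAB : A ⊆ B)
    (hAideal : ∀ a ∈ A, ∀ b ∈ B, a * b ∈ A ∧ b * a ∈ A)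
    (hcai : IsCaiFor E A A)
    (hess : ∀ x : E, (∀ j ∈ cstarGen E A, x * j = 0 ∧ j * x = 0) → x = 0) :
    ∀ b ∈ B, ‖b‖ = sSup {r : ℝ | ∃ a ∈ A, ‖a‖ ≤ 1 ∧ r = ‖b * a‖} := by
  obtain ⟨ι, l, e, hl, heA, he, hleft, hright⟩ := hcai
  have hJ : IsClosedSubalg E (cstarGen E A) := isClosedSubalg_cstarGen
  have hlim : ∀ j ∈ cstarGen E A,
      Tendsto (fun t => e t * j) l (𝓝 j) ∧ Tendsto (fun t => star (e t) * j) l (𝓝 j) :=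
    fun j hj => tendsto_mul_of_mem_cstarGen he
      (fun a ha => tendsto_iff_norm_sub_tendsto_zero.2 (hleft a ha))
      (fun a ha => tendsto_iff_norm_sub_tendsto_zero.2 (hright a ha)) hj
  have hBJ : ∀ b ∈ B, ∀ j ∈ cstarGen E A, b * j ∈ cstarGen E A ∧ star b * j ∈ cstarGen E A := by
    refine fun b hb j hj =>
      ⟨hJ.isClosed.mem_of_tendsto ((hlim j hj).1.const_mul b) (.of_forall fun t => ?_),
        hJ.isClosed.mem_of_tendsto ((hlim j hj).2.const_mul (star b)) (.of_forall fun t => ?_)⟩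
    · rw [← mul_assoc]
      exact hJ.mul_mem (subset_cstarGen (hAideal _ (heA t) b hb).2) hj
    · rw [← mul_assoc, ← star_mul]
      exact hJ.mul_mem (star_mem_cstarGen (subset_cstarGen (hAideal _ (heA t) b hb).1)) hj
  have hEJ : ∀ x : E, ∀ j ∈ cstarGen E A, x * j ∈ cstarGen E A := by
    intro x j hj
    have hx : x ∈ cstarGen E B := hBgen ▸ Set.mem_univ x
    refine (cstarGen_subset (T := {x | ∀ j ∈ cstarGen E A,
      x * j ∈ cstarGen E A ∧ star x * j ∈ cstarGen E A}) ⟨?_, ?_, ?_, ?_, ?_⟩ ?_ hBJ hx j hj).1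
    · simp only [Set.ofPred_forall]
      exact isClosed_biInter fun j _ => (hJ.isClosed.preimage (continuous_mul_const j)).inter
        (hJ.isClosed.preimage (continuous_star.mul continuous_const))
    · exact fun j _ => by simpa using hJ.zero_mem
    · exact fun hx hy j hj => ⟨by simpa [add_mul] using hJ.add_mem (hx j hj).1 (hy j hj).1,
        by simpa [add_mul] using hJ.add_mem (hx j hj).2 (hy j hj).2⟩
    · exact fun c x hx j hj => ⟨by simpa [smul_mul_assoc] using hJ.smul_mem c (hx j hj).1,
        by simpa [smul_mul_assoc] using hJ.smul_mem (star c) (hx j hj).2⟩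
    · exact fun hx hy j hj => ⟨by simpa [mul_assoc] using (hx _ (hy j hj).1).1,
        by simpa [mul_assoc] using (hy _ (hx j hj).2).2⟩
    · exact fun x hx j hj => ⟨(hx j hj).2, by simpa using (hx j hj).1⟩
  intro b hb
  have hub : ∀ r ∈ {r : ℝ | ∃ a ∈ A, ‖a‖ ≤ 1 ∧ r = ‖b * a‖}, r ≤ ‖b‖ := by
    rintro _ ⟨a, -, ha, rfl⟩
    exact (norm_mul_le _ _).trans (mul_le_of_le_one_right (norm_nonneg _) ha)
  have hle : ∀ a ∈ A, ‖a‖ ≤ 1 → ‖b * a‖ ≤ sSup {r : ℝ | ∃ a ∈ A, ‖a‖ ≤ 1 ∧ r = ‖b * a‖} :=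
    fun a ha ha₁ => le_csSup ⟨_, hub⟩ ⟨a, ha, ha₁, rfl⟩
  refine le_antisymm (norm_le_of_forall_norm_mul_le hEJ ?_ ?_ ?_)
    (csSup_le ⟨_, 0, hA.zero_mem, by simp, rfl⟩ hub)
  · refine fun c hc h => hess c fun j hj => ⟨h j hj, ?_⟩
    have := congrArg star (h _ (star_mem_cstarGen hj))
    simpa [hc.star_eq] using this
  · simpa using hle 0 hA.zero_mem (by simp)
  · intro j hj
    refine le_of_tendsto ((hlim j hj).1.const_mul b).norm (.of_forall fun t => ?_)
    rw [← mul_assoc]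
    exact (norm_mul_le _ _).trans
      (mul_le_mul_of_nonneg_right (hle _ (heA t) (he t)) (norm_nonneg _))
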